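/- For every π ∈ G_{r,n} and all integers j, k ≥ 0, the identity binomial(r·j·k + j + k + n − des(π), n) = Σ_{σ ∈ G_{r,n}} binomial(j + n − des(σ), n) · binomial(k + n − des(σ⁻¹·π), n) holds, where the sum is over all σ ∈ G_{r,n} and σ⁻¹·π is computed in the group G_{r,n}. (This is the coefficient-wise form of the generating-function identity Σ_{j,k≥0} binomial(rjk+j+k+n−des(π), n) s^j t^k = (Σ_{στ=π} s^{des(σ)} t^{des(τ)}) / ((1−s)^{n+1}(1−t)^{n+1}).) -/

import Mathlib

open scoped BigOperators

/-- Lexicographic (color-first) strict order on colored letters `(value, color)`. -/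
def letterLT (x y : ℕ × ℕ) : Prop :=
  x.2 < y.2 ∨ (x.2 = y.2 ∧ x.1 < y.1)

instance : DecidableRel letterLT := fun x y => by
  unfold letterLT; infer_instance

/-- The colored permutation group `G_{r,n}`. -/
@[ext] structure ColoredPerm (r n : ℕ) where
  perm : Equiv.Perm (Fin n)
  col : Fin n → ZMod r

namespace ColoredPerm

variable {r n : ℕ}

instance : Mul (ColoredPerm r n) :=
  ⟨fun a b => ⟨a.perm * b.perm, fun i => a.col (b.perm i) + b.col i⟩⟩

instance : One (ColoredPerm r n) :=
  ⟨⟨1, fun _ => 0⟩⟩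

instance : Inv (ColoredPerm r n) :=
  ⟨fun a => ⟨a.perm⁻¹, fun i => -a.col (a.perm⁻¹ i)⟩⟩

instance : Group (ColoredPerm r n) where
  mul_assoc a b c := by
    refine ColoredPerm.ext (mul_assoc _ _ _) ?_
    funext i
    show a.col (b.perm (c.perm i)) + b.col (c.perm i) + c.col i
        = a.col ((b.perm * c.perm) i) + (b.col (c.perm i) + c.col i)
    rw [Equiv.Perm.mul_apply, add_assoc]
  one_mul a := by
    refine ColoredPerm.ext (one_mul _) ?_
    funext i
    show (0 : ZMod r) + a.col i = a.col i
    rw [zero_add]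
  mul_one a := by
    refine ColoredPerm.ext (mul_one _) ?_
    funext i
    show a.col ((1 : Equiv.Perm (Fin n)) i) + 0 = a.col i
    simp
  inv_mul_cancel a := by
    refine ColoredPerm.ext (inv_mul_cancel _) ?_
    funext i
    show -a.col (a.perm⁻¹ (a.perm i)) + a.col i = 0
    simp

/-- `ColoredPerm r n` is equivalent (as a type) to a product. -/
def toProd : ColoredPerm r n ≃ Equiv.Perm (Fin n) × (Fin n → ZMod r) where
  toFun a := (a.perm, a.col)
  invFun p := ⟨p.1, p.2⟩
  left_inv _ := rfl
  right_inv _ := rfl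

instance [NeZero r] : Fintype (ColoredPerm r n) := Fintype.ofEquiv _ toProd.symm

instance : DecidableEq (ColoredPerm r n) := toProd.decidableEq

/-- The `i`-th letter of the one-line notation (0-indexed), as a pair (value, color);
for `i = n` this is the sentinel letter `0₁`. Values are in `{1, …, n}`. -/
def letterAt (a : ColoredPerm r n) (i : ℕ) : ℕ × ℕ :=
  if h : i < n then ((a.perm ⟨i, h⟩ : ℕ) + 1, (a.col ⟨i, h⟩).val) else (0, 1)

/-- The descent set of a colored permutation (positions 0-indexed: position `i`
corresponds to the paper's `i+1 ∈ {1, …, n}`). -/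
def Des (a : ColoredPerm r n) : Finset (Fin n) :=
  Finset.univ.filter fun i : Fin n => letterLT (letterAt a (i.1 + 1)) (letterAt a i.1)

/-- The descent number. -/
def des (a : ColoredPerm r n) : ℕ := (Des a).card

/-- The internal descent number `|Des(π) ∩ {1, …, n−1}|`. -/
def intdes (a : ColoredPerm r n) : ℕ :=
  ((Des a).filter fun i : Fin n => i.1 + 1 < n).card

end ColoredPerm

open Finset

/-- Extend a finite sequence to `ℕ` by a constant. -/
def extendConst {n : ℕ} {α : Type*} (f : Fin n → α) (b : α) (i : ℕ) : α :=
  if h : i < n then f ⟨i, h⟩ else b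

theorem extendConst_of_lt {n : ℕ} {α : Type*} (f : Fin n → α) (b : α) {i : ℕ} (h : i < n) :
    extendConst f b i = f ⟨i, h⟩ := dif_pos h

theorem extendConst_self {n : ℕ} {α : Type*} (f : Fin n → α) (b : α) :
    extendConst f b n = b := dif_neg (lt_irrefl n)

theorem strictMonoOn_extendConst {n : ℕ} {α : Type*} [Preorder α] (f : Fin n → α) (b : α) :
    StrictMonoOn (extendConst f b) (Set.Iic n) ↔ StrictMono f ∧ ∀ i, f i < b := by
  constructor
  · intro h
    refine ⟨fun i j hij => ?_, fun i => ?_⟩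
    · have := h (Set.mem_Iic.2 i.2.le) (Set.mem_Iic.2 j.2.le) (Fin.lt_def.1 hij)
      rwa [extendConst_of_lt _ _ i.2, extendConst_of_lt _ _ j.2] at this
    · have := h (Set.mem_Iic.2 i.2.le) (Set.mem_Iic.2 le_rfl) i.2
      rwa [extendConst_of_lt _ _ i.2, extendConst_self] at this
  · rintro ⟨h, hb⟩ i _ j hj hij
    have hj : j ≤ n := hj
    rw [extendConst_of_lt _ _ (hij.trans_le hj)]
    rcases hj.eq_or_lt with rfl | hj
    · rw [extendConst_self]; exact hb _
    · rw [extendConst_of_lt _ _ hj]; exact h (Fin.lt_def.2 hij)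

theorem strictMonoOn_Iic_iff {α : Type*} [Preorder α] (f : ℕ → α) (n : ℕ) :
    StrictMonoOn f (Set.Iic n) ↔ ∀ i < n, f i < f (i + 1) :=
  ⟨fun h i hi => h (Set.mem_Iic.2 hi.le) (Set.mem_Iic.2 hi) i.lt_succ_self,
    fun h => strictMonoOn_of_lt_add_one Set.ordConnected_Iic
      fun i _ _ hi => h i (Nat.succ_le_iff.1 hi)⟩

/-- Words of length `n` in the alphabet `{0, …, m - 1}`. -/
def words (n m : ℕ) : Finset (Fin n → ℕ) := Fintype.piFinset fun _ => range m

theorem mem_words {n m : ℕ} {w : Fin n → ℕ} : w ∈ words n m ↔ ∀ i, w i < m := by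
  simp [words]

theorem card_strictMono_words (n m : ℕ) :
    #{y ∈ words n m | StrictMono y} = m.choose n := by
  classical
  rw [← card_range m, ← card_powersetCard, card_range]
  refine card_bij (fun y _ => univ.image y) ?_ ?_ ?_
  · intro y hy
    rw [mem_filter, mem_words] at hy
    rw [mem_powersetCard, card_image_of_injective _ hy.2.injective, card_univ, Fintype.card_fin]
    exact ⟨by intro x; simp only [mem_image, mem_univ, true_and, mem_range]
              rintro ⟨i, rfl⟩; exact hy.1 i, rfl⟩
  · intro y hy z hz h
    rw [mem_filter] at hy hz
    refine (hy.2.range_inj hz.2).1 ?_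
    simpa using congrArg (fun s : Finset ℕ => (s : Set ℕ)) h
  · intro s hs
    rw [mem_powersetCard] at hs
    refine ⟨s.orderEmbOfFin hs.2, ?_, by simp⟩
    rw [mem_filter, mem_words]
    exact ⟨fun i => mem_range.1 (hs.1 (orderEmbOfFin_mem s hs.2 i)), OrderEmbedding.strictMono _⟩

theorem toLex_letter_lt_iff {r x x' c c' p p' : ℕ} (hc : c < r) (hc' : c' ≤ r)
    (hp : p ≠ p') (hr : c' = r → p' < p) :
    (toLex (r * x + c, p) : ℕ ×ₗ ℕ) < toLex (r * x' + c', p') ↔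
      x + (if letterLT (p', c') (p, c) then 1 else 0) ≤ x' := by
  rw [Prod.Lex.toLex_lt_toLex]
  have hL : letterLT (p', c') (p, c) ↔ c' < c ∨ c' = c ∧ p' < p := Iff.rfl
  dsimp only
  rcases lt_trichotomy x x' with h | rfl | h
  · have h1 : r * x + r ≤ r * x' := by rw [← Nat.mul_succ]; exact Nat.mul_le_mul_left r h
    split_ifs with hd <;> rw [hL] at hd <;> omega
  · split_ifs with hd <;> rw [hL] at hd <;> omega
  · have h1 : r * x' + r ≤ r * x := by rw [← Nat.mul_succ]; exact Nat.mul_le_mul_left r h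
    split_ifs with hd <;> rw [hL] at hd <;> omega

namespace ColoredPerm

variable {r n : ℕ}

/-- The colored permutation that stably sorts a word, the colors being the residues modulo `r` of
the sorted word. -/
def standardize (r : ℕ) (w : Fin n → ℕ) : ColoredPerm r n :=
  ⟨Tuple.sort w, fun i => (w (Tuple.sort w i) : ZMod r)⟩

theorem perm_mul (a b : ColoredPerm r n) : (a * b).perm = a.perm * b.perm := rfl

theorem col_mul (a b : ColoredPerm r n) (i : Fin n) :
    (a * b).col i = a.col (b.perm i) + b.col i := rfl

theorem standardize_eq_iff (w : Fin n → ℕ) (σ : ColoredPerm r n) :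
    standardize r w = σ ↔ σ.perm = Tuple.sort w ∧ ∀ i, (w (σ.perm i) : ZMod r) = σ.col i := by
  constructor
  · rintro rfl; exact ⟨rfl, fun _ => rfl⟩
  · rintro ⟨h, hc⟩
    refine ColoredPerm.ext h.symm (funext fun i => ?_)
    rw [← hc i, h]; rfl

theorem standardize_mul_standardize {m : ℕ} (hm : (m : ZMod r) = 1) (W u : Fin n → ℕ)
    (hW : ∀ i, W i < m) :
    standardize r W * standardize r u =
      standardize r fun v => m * u ((Tuple.sort W).symm v) + W v := by
  symm
  rw [standardize_eq_iff]
  have hs := (Tuple.eq_sort_iff (f := W)).1 rfl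
  have ht := (Tuple.eq_sort_iff (f := u)).1 rfl
  have lt_aux : ∀ {a b c d : ℕ}, c < m → a < b → m * a + c < m * b + d := by
    intro a b c d hc hab
    have := Nat.mul_le_mul_left m hab
    rw [Nat.mul_succ] at this
    omega
  constructor
  · rw [Tuple.eq_sort_iff]
    constructor
    · intro i j hij
      simp only [Function.comp, perm_mul, standardize, Equiv.Perm.mul_apply,
        Equiv.symm_apply_apply]
      rcases (ht.1 hij).lt_or_eq with h | h
      · exact (lt_aux (hW _) h).le
      · simp only [Function.comp] at h
        rw [h]
        refine Nat.add_le_add_left ?_ _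
        rcases hij.eq_or_lt with rfl | hij
        · exact le_rfl
        · exact hs.1 (ht.2 i j hij h).le
    · intro i j hij
      simp only [perm_mul, standardize, Equiv.Perm.mul_apply, Equiv.symm_apply_apply]
      intro h
      have hu : u (Tuple.sort u i) = u (Tuple.sort u j) := by
        rcases lt_trichotomy (u (Tuple.sort u i)) (u (Tuple.sort u j)) with h' | h' | h'
        · exact absurd h (lt_aux (hW _) h').ne
        · exact h'
        · exact absurd h (lt_aux (hW _) h').ne'
      rw [hu] at h
      exact hs.2 _ _ (ht.2 i j hij hu) (Nat.add_left_cancel h)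
  · intro i
    simp only [perm_mul, col_mul, standardize, Equiv.Perm.mul_apply, Equiv.symm_apply_apply]
    push_cast
    rw [hm, one_mul, add_comm]

/-- The number of non-descents at positions before `i`. -/
def ascentsBefore (σ : ColoredPerm r n) (i : ℕ) : ℕ :=
  #{d : Fin n | d.1 < i ∧ d ∉ Des σ}

theorem ascentsBefore_succ (σ : ColoredPerm r n) {i : ℕ} (hi : i < n) :
    ascentsBefore σ (i + 1) +
      (if letterLT (letterAt σ (i + 1)) (letterAt σ i) then 1 else 0) = ascentsBefore σ i + 1 := by
  have hD : (⟨i, hi⟩ : Fin n) ∈ Des σ ↔ letterLT (letterAt σ (i + 1)) (letterAt σ i) := by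
    simp [Des]
  unfold ascentsBefore
  split_ifs with h
  · congr 2
    ext d
    simp only [mem_filter, mem_univ, true_and]
    refine and_congr_left fun hd => ?_
    have : d.1 ≠ i := fun h' => hd (by rw [← hD] at h; convert h)
    omega
  · rw [add_zero, ← card_insert_of_notMem (a := (⟨i, hi⟩ : Fin n)) (by simp)]
    congr 1
    ext d
    simp only [mem_filter, mem_univ, true_and, mem_insert, Fin.ext_iff]
    constructor
    · rintro ⟨h1, h2⟩
      by_cases h3 : d.1 = i
      · exact Or.inl h3
      · exact Or.inr ⟨by omega, h2⟩
    · rintro (h1 | ⟨h1, h2⟩)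
      · refine ⟨by omega, ?_⟩
        have : d = ⟨i, hi⟩ := Fin.ext h1
        rwa [this, hD]
      · exact ⟨by omega, h2⟩

theorem ascentsBefore_zero (σ : ColoredPerm r n) : ascentsBefore σ 0 = 0 := by
  simp [ascentsBefore]

theorem ascentsBefore_add_des (σ : ColoredPerm r n) : ascentsBefore σ n + des σ = n := by
  have h := card_filter_add_card_filter_not (s := (univ : Finset (Fin n))) (fun d => d ∈ Des σ)
  rw [card_univ, Fintype.card_fin] at h
  simp only [filter_mem_eq_inter, univ_inter] at h
  simp only [ascentsBefore, Fin.is_lt, true_and, des]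
  omega

theorem ascentsBefore_le_of_strictMono (σ : ColoredPerm r n) {y : Fin n → ℕ} (hy : StrictMono y)
    (i : Fin n) : ascentsBefore σ i ≤ y i := by
  obtain ⟨i, hi⟩ := i
  induction i with
  | zero => simp [ascentsBefore_zero]
  | succ i ih =>
    have h1 := ih (by omega)
    have h2 := ascentsBefore_succ σ (i := i) (by omega)
    have h3 : y ⟨i, by omega⟩ < y ⟨i + 1, hi⟩ := hy (Fin.lt_def.2 i.lt_succ_self)
    dsimp only at h1 ⊢
    omega

theorem perm_eq_sort_and_mem_words_iff (σ : ColoredPerm r n) (w : Fin n → ℕ) (m : ℕ) :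
    σ.perm = Tuple.sort w ∧ w ∈ words n m ↔
      StrictMonoOn (extendConst (fun i => (toLex (w (σ.perm i), (σ.perm i : ℕ) + 1) : ℕ ×ₗ ℕ))
        (toLex (m, 0))) (Set.Iic n) := by
  rw [strictMonoOn_extendConst, mem_words]
  refine and_congr ?_ ?_
  · rw [Tuple.eq_sort_iff]
    constructor
    · rintro ⟨h1, h2⟩ i j hij
      rw [Prod.Lex.toLex_lt_toLex]
      rcases (h1 hij.le).lt_or_eq with h | h
      · exact Or.inl h
      · exact Or.inr ⟨h, Nat.succ_lt_succ (h2 i j hij h)⟩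
    · intro h
      simp only [StrictMono, Prod.Lex.toLex_lt_toLex] at h
      refine ⟨monotone_iff_forall_lt.2 fun i j hij => ?_, fun i j hij he => ?_⟩
      · rcases h hij with h | h
        · exact h.le
        · exact h.1.le
      · rcases h hij with h | h
        · exact absurd he h.ne
        · exact Nat.lt_of_succ_lt_succ h.2
  · simp only [Prod.Lex.toLex_lt_toLex, not_lt_zero, and_false, or_false]
    exact (σ.perm.forall_congr_left (p := fun v => w (σ.perm v) < m)).trans (by simp) |>.symm

theorem natCast_eq_iff_mod_eq_val [NeZero r] (a : ℕ) (c : ZMod r) :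
    (a : ZMod r) = c ↔ a % r = c.val := by
  rw [← (ZMod.val_injective r).eq_iff, ZMod.val_natCast]

theorem standardize_eq_and_mem_words_iff [NeZero r] (σ : ColoredPerm r n) (w : Fin n → ℕ) (j : ℕ)
    (hw : ∀ i, w (σ.perm i) % r = (σ.col i).val) :
    (standardize r w = σ ∧ w ∈ words n (r * j + 1)) ↔
      StrictMono (fun i : Fin n => w (σ.perm i) / r + ascentsBefore σ i) ∧
        (fun i : Fin n => w (σ.perm i) / r + ascentsBefore σ i) ∈ words n (j + n - des σ) := by
  rw [standardize_eq_iff, and_iff_left fun i => (natCast_eq_iff_mod_eq_val _ _).2 (hw i),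
    perm_eq_sort_and_mem_words_iff, mem_words, ← strictMonoOn_extendConst, strictMonoOn_Iic_iff,
    strictMonoOn_Iic_iff]
  refine forall₂_congr fun i hi => ?_
  have hr : 0 < r := Nat.pos_of_ne_zero (NeZero.ne r)
  have hA := ascentsBefore_succ σ hi
  have hn := ascentsBefore_add_des σ
  have hdecomp : ∀ i, w (σ.perm i) = r * (w (σ.perm i) / r) + (σ.col i).val := fun i => by
    rw [← hw]; exact (Nat.div_add_mod _ _).symm
  have hcol : ∀ i, (σ.col i).val < r := fun i => ZMod.val_lt _
  rw [extendConst_of_lt _ _ hi, extendConst_of_lt _ _ hi]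
  by_cases hi' : i + 1 < n
  · rw [extendConst_of_lt _ _ hi', extendConst_of_lt _ _ hi', hdecomp ⟨i, hi⟩, hdecomp ⟨i + 1, hi'⟩,
      toLex_letter_lt_iff (hcol _) (hcol _).le
        (fun h => by simp [← Fin.ext_iff] at h)
        (fun h => absurd h (hcol _).ne), ← hdecomp, ← hdecomp]
    simp only [letterAt, hi, hi', dif_pos] at hA
    dsimp only
    omega
  · obtain rfl : n = i + 1 := by omega
    rw [extendConst_self, extendConst_self, hdecomp ⟨i, hi⟩,
      toLex_letter_lt_iff (c' := 1) (hcol _) hr (Nat.add_one_ne_zero _)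
        (fun _ => Nat.succ_pos _), ← hdecomp]
    simp only [letterAt, hi, lt_irrefl, dif_pos, dif_neg, not_false_eq_true] at hA
    dsimp only
    omega

theorem card_standardize_eq [NeZero r] (σ : ColoredPerm r n) (j : ℕ) :
    #{w ∈ words n (r * j + 1) | standardize r w = σ} = (j + n - des σ).choose n := by
  rw [← card_strictMono_words]
  have hr : 0 < r := Nat.pos_of_ne_zero (NeZero.ne r)
  have hmod : ∀ w : Fin n → ℕ, standardize r w = σ → ∀ i, w (σ.perm i) % r = (σ.col i).val :=
    fun w hw i => (natCast_eq_iff_mod_eq_val _ _).1 (((standardize_eq_iff w σ).1 hw).2 i)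
  have hlt : ∀ i, (σ.col i).val < r := fun i => ZMod.val_lt _
  refine card_nbij' (fun w i => w (σ.perm i) / r + ascentsBefore σ i)
    (fun y v => r * (y (σ.perm.symm v) - ascentsBefore σ (σ.perm.symm v)) +
      (σ.col (σ.perm.symm v)).val) ?_ ?_ ?_ ?_
  · intro w hw
    rw [mem_coe, mem_filter] at hw ⊢
    exact ((standardize_eq_and_mem_words_iff σ w j (hmod w hw.2)).1 hw.symm).symm
  · intro y hy
    rw [mem_coe, mem_filter] at hy ⊢
    refine ((standardize_eq_and_mem_words_iff σ _ j fun i => ?_).2 ?_).symm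
    · simp [Nat.mod_eq_of_lt (hlt i)]
    · have : (fun i : Fin n => (r * (y (σ.perm.symm (σ.perm i)) -
          ascentsBefore σ (σ.perm.symm (σ.perm i))) +
            (σ.col (σ.perm.symm (σ.perm i))).val) / r + ascentsBefore σ i) = y := by
        funext i
        rw [Equiv.symm_apply_apply, Nat.mul_add_div hr, Nat.div_eq_of_lt (hlt i), add_zero,
          Nat.sub_add_cancel (ascentsBefore_le_of_strictMono σ hy.2 i)]
      rw [this]
      exact hy.symm
  · intro w hw
    rw [mem_coe, mem_filter] at hw
    funext v
    dsimp only
    rw [Equiv.apply_symm_apply, Nat.add_sub_cancel, ← hmod w hw.2, Equiv.apply_symm_apply,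
      Nat.div_add_mod]
  · intro y hy
    rw [mem_coe, mem_filter] at hy
    funext i
    dsimp only
    rw [Equiv.symm_apply_apply, Nat.mul_add_div hr, Nat.div_eq_of_lt (hlt i), add_zero,
      Nat.sub_add_cancel (ascentsBefore_le_of_strictMono σ hy.2 i)]

theorem card_standardize_mul_eq (π : ColoredPerm r n) {m m' : ℕ} (hm : (m : ZMod r) = 1)
    (hpos : 0 < m) :
    #{p ∈ words n m ×ˢ words n m' | standardize r p.1 * standardize r p.2 = π} =
      #{z ∈ words n (m * m') | standardize r z = π} := by
  have hinv : ∀ p : (Fin n → ℕ) × (Fin n → ℕ), p.1 ∈ words n m →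
      (fun v => (m * p.2 ((Tuple.sort p.1).symm v) + p.1 v) % m) = p.1 := fun p hp => by
    funext v
    rw [Nat.mul_add_mod, Nat.mod_eq_of_lt (mem_words.1 hp v)]
  have hinv' : ∀ z : Fin n → ℕ, (fun v => m * (z (Tuple.sort (fun v => z v % m)
      ((Tuple.sort (fun v => z v % m)).symm v)) / m) + z v % m) = z := fun z => by
    funext v
    rw [Equiv.apply_symm_apply, Nat.div_add_mod]
  refine card_nbij'
    (fun p v => m * p.2 ((Tuple.sort p.1).symm v) + p.1 v)
    (fun z => (fun v => z v % m, fun i => z (Tuple.sort (fun v => z v % m) i) / m)) ?_ ?_ ?_ ?_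
  · intro p hp
    rw [mem_coe, mem_filter, mem_product] at hp
    rw [mem_coe, mem_filter, mem_words, ← standardize_mul_standardize hm _ _ (mem_words.1 hp.1.1)]
    refine ⟨fun v => ?_, hp.2⟩
    have h1 := mem_words.1 hp.1.1 v
    have h2 := Nat.mul_le_mul_left m (mem_words.1 hp.1.2 ((Tuple.sort p.1).symm v))
    rw [Nat.mul_succ] at h2
    dsimp only
    omega
  · intro z hz
    rw [mem_coe, mem_filter, mem_words] at hz
    rw [mem_coe, mem_filter, mem_product, mem_words, mem_words,
      standardize_mul_standardize hm _ _ fun v => Nat.mod_lt _ hpos]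
    refine ⟨⟨fun v => Nat.mod_lt _ hpos, fun v => ?_⟩, ?_⟩
    · exact Nat.div_lt_of_lt_mul (hz.1 _)
    · rw [hinv' z, hz.2]
  · intro p hp
    rw [mem_coe, mem_filter, mem_product] at hp
    refine Prod.ext (hinv p hp.1.1) ?_
    funext i
    dsimp only
    rw [hinv p hp.1.1, Equiv.symm_apply_apply, Nat.mul_add_div hpos,
      Nat.div_eq_of_lt (mem_words.1 hp.1.1 _), add_zero]
  · intro z _
    exact hinv' z

end ColoredPerm

open ColoredPerm in
/-- For every `π ∈ G_{r,n}` and all `j, k ≥ 0`,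
`C(rjk+j+k+n−des(π), n) = Σ_{σ ∈ G_{r,n}} C(j+n−des(σ), n) · C(k+n−des(σ⁻¹π), n)`. -/
theorem colored_descent_convolution (r n : ℕ) [NeZero r] (hn : 1 ≤ n)
    (π : ColoredPerm r n) (j k : ℕ) :
    (r * j * k + j + k + n - des π).choose n =
      ∑ σ : ColoredPerm r n,
        (j + n - des σ).choose n * (k + n - des (σ⁻¹ * π)).choose n := by
  have hm : ((r * j + 1 : ℕ) : ZMod r) = 1 := by simp
  have hN : (r * j + 1) * (r * k + 1) = r * (r * j * k + j + k) + 1 := by ring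
  rw [← card_standardize_eq π (r * j * k + j + k), ← hN,
    ← card_standardize_mul_eq π hm (Nat.succ_pos _),
    card_eq_sum_card_fiberwise (f := fun p => standardize r p.1) (t := univ)
      fun _ _ => mem_coe.2 (mem_univ _)]
  refine sum_congr rfl fun σ _ => ?_
  rw [← card_standardize_eq σ j, ← card_standardize_eq (σ⁻¹ * π) k, ← card_product]
  congr 1
  ext p
  simp only [mem_filter, mem_product, eq_inv_mul_iff_mul_eq]
  constructor
  · rintro ⟨⟨⟨h1, h2⟩, h3⟩, rfl⟩
    exact ⟨⟨h1, rfl⟩, h2, h3⟩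
  · rintro ⟨⟨h1, rfl⟩, h2, h3⟩
    exact ⟨⟨⟨h1, h2⟩, h3⟩, rfl⟩
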